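/- arXiv:2502.02273 — 6 statements merged into one kernel-verified Lean document; each statement's English description precedes it below -/
import Mathlib

section
/- Let a < b be real numbers, let β₁, β₂ > −1, and let g : [a, b] → ℝ be continuous. Define h(s) = (s−a)^{β₁} (b−s)^{β₂} g(s) for s ∈ (a, b), and for each positive integer N set λ_j^N = a + j(b−a)/(N+1) for j = 1, …, N. Then h is Lebesgue integrable on (a, b) and the Riemann-type sums ((b−a)/N) · Σ_{j=1}^{N} h(λ_j^N) converge, as N → ∞, to the (improper) integral ∫_a^b h(s) ds. -/
open MeasureTheory Set Filter

/-- The function `h(s) = (s-a)^{β₁} (b-s)^{β₂} g(s)` with possible power-type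
singularities at the endpoints. -/
noncomputable def reflectionDensity (a b β₁ β₂ : ℝ) (g : ℝ → ℝ) (s : ℝ) : ℝ :=
  (s - a) ^ β₁ * (b - s) ^ β₂ * g s

/-- The smallest node of the grid `a + δ ℕ` lying to the right of `s`. -/
noncomputable def ceilNode (a δ s : ℝ) : ℝ := a + ⌈(s - a) / δ⌉₊ * δ

lemma le_ceilNode {a δ s : ℝ} (hδ : 0 < δ) : s ≤ ceilNode a δ s := by
  have h := Nat.le_ceil ((s - a) / δ)
  rw [div_le_iff₀ hδ] at h
  unfold ceilNode
  linarith

lemma ceilNode_lt {a δ s : ℝ} (hδ : 0 < δ) (hs : a ≤ s) : ceilNode a δ s < s + δ := by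
  have h := Nat.ceil_lt_add_one (div_nonneg (sub_nonneg.2 hs) hδ.le)
  have h' := mul_lt_mul_of_pos_right h hδ
  rw [add_mul, div_mul_cancel₀ _ hδ.ne', one_mul] at h'
  unfold ceilNode
  linarith

lemma ceilNode_eq {a δ s : ℝ} (hδ : 0 < δ) (k : ℕ)
    (hs : s ∈ Ioc (a + k * δ) (a + (k + 1 : ℕ) * δ)) :
    ceilNode a δ s = a + (k + 1 : ℕ) * δ := by
  have h : ⌈(s - a) / δ⌉₊ = k + 1 := by
    rw [Nat.ceil_eq_iff k.succ_ne_zero, lt_div_iff₀ hδ, div_le_iff₀ hδ]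
    constructor
    · simpa using by linarith [hs.1]
    · linarith [hs.2]
  rw [ceilNode, h]

/-- A node inside `(a, b)` is at least one mesh size away from `b`. -/
lemma ceilNode_le_sub {a b δ s : ℝ} (hδ : 0 < δ) (n : ℕ) (hb : b = a + (n + 1 : ℕ) * δ)
    (h : ceilNode a δ s < b) : ceilNode a δ s ≤ b - δ := by
  rw [ceilNode, hb, add_lt_add_iff_left, mul_lt_mul_iff_left₀ hδ, Nat.cast_lt,
    Nat.lt_succ_iff] at h
  have h' : (⌈(s - a) / δ⌉₊ : ℝ) * δ ≤ n * δ := by gcongr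
  rw [ceilNode, hb]
  push_cast
  linarith

lemma intervalIntegrable_comp_ceilNode_cell (H : ℝ → ℝ) {a δ : ℝ} (hδ : 0 < δ) (k : ℕ) :
    IntervalIntegrable (fun s => H (ceilNode a δ s)) volume
      (a + k * δ) (a + (k + 1 : ℕ) * δ) := by
  have hle : a + k * δ ≤ a + (k + 1 : ℕ) * δ := by push_cast; linarith
  refine (intervalIntegrable_const (c := H (a + (k + 1 : ℕ) * δ))).congr fun s hs => ?_
  rw [uIoc_of_le hle] at hs
  simp only [ceilNode_eq hδ k hs]

lemma intervalIntegrable_comp_ceilNode (H : ℝ → ℝ) {a δ : ℝ} (hδ : 0 < δ) (n : ℕ) :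
    IntervalIntegrable (fun s => H (ceilNode a δ s)) volume a (a + n * δ) := by
  simpa using IntervalIntegrable.trans_iterate (a := fun k : ℕ => a + k * δ) (n := n)
    fun k _ => intervalIntegrable_comp_ceilNode_cell H hδ k

lemma integral_comp_ceilNode (H : ℝ → ℝ) {a δ : ℝ} (hδ : 0 < δ) (n : ℕ) :
    ∫ s in a..(a + n * δ), H (ceilNode a δ s) =
      δ * ∑ k ∈ Finset.range n, H (a + (k + 1 : ℕ) * δ) := by
  have h := intervalIntegral.sum_integral_adjacent_intervals (a := fun k : ℕ => a + k * δ) (n := n)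
    fun k _ => intervalIntegrable_comp_ceilNode_cell H hδ k
  simp only [Nat.cast_zero, zero_mul, add_zero] at h
  rw [← h, Finset.mul_sum]
  refine Finset.sum_congr rfl fun k _ => ?_
  have hle : a + k * δ ≤ a + (k + 1 : ℕ) * δ := by push_cast; linarith
  rw [intervalIntegral.integral_of_le hle, setIntegral_congr_fun measurableSet_Ioc
    (g := fun _ => H (a + (k + 1 : ℕ) * δ)) fun s hs => by simp only [ceilNode_eq hδ k hs],
    ← intervalIntegral.integral_of_le hle, intervalIntegral.integral_const, smul_eq_mul]
  push_cast
  ring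

lemma tendsto_ceilNode {a s : ℝ} (hs : a ≤ s) {δ : ℕ → ℝ} (hδ : ∀ n, 0 < δ n)
    (hlim : Tendsto δ atTop (nhds 0)) :
    Tendsto (fun n => ceilNode a (δ n) s) atTop (nhds s) := by
  refine tendsto_of_tendsto_of_tendsto_of_le_of_le tendsto_const_nhds
    (by simpa using tendsto_const_nhds.add hlim) (fun n => le_ceilNode (hδ n))
    (fun n => (ceilNode_lt (hδ n) hs).le)

lemma rpow_le_rpow_add_rpow {x y L : ℝ} (β : ℝ) (hx : 0 < x) (hxy : x ≤ y) (hyL : y ≤ L) :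
    y ^ β ≤ x ^ β + L ^ β := by
  have hy := hx.trans_le hxy
  rcases le_total 0 β with h | h
  · linarith [Real.rpow_le_rpow hy.le hyL h, Real.rpow_nonneg hx.le β]
  · linarith [Real.rpow_le_rpow_of_nonpos hx hxy h, Real.rpow_nonneg (hy.le.trans hyL) β]

/-- The product of a function that is singular only at `a` and one that is singular only at `b`
is integrable. -/
lemma integrableOn_mul_of_singular_endpoints {a b : ℝ} (hab : a < b) {φ ψ : ℝ → ℝ}
    (hφ : IntegrableOn φ (Ioo a b)) (hψ : IntegrableOn ψ (Ioo a b))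
    (hφc : ContinuousOn φ (Ioi a)) (hψc : ContinuousOn ψ (Iio b)) :
    IntegrableOn (fun s => φ s * ψ s) (Ioo a b) := by
  obtain ⟨m, ham, hmb⟩ := exists_between hab
  rw [← Ioc_union_Ioo_eq_Ioo ham.le hmb]
  refine IntegrableOn.union ?_ ?_
  · exact (hφ.mono_set fun s hs => ⟨hs.1, hs.2.trans_lt hmb⟩).mul_continuousOn_of_subset
      (hψc.mono fun s hs => hs.2.trans_lt hmb) measurableSet_Ioc isCompact_Icc
      Ioc_subset_Icc_self
  · exact (hψ.mono_set fun s hs => ⟨ham.trans hs.1, hs.2⟩).continuousOn_mul_of_subset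
      (hφc.mono fun s hs => ham.trans_le hs.1) isCompact_Icc measurableSet_Ioo
      Ioo_subset_Icc_self

/-- A dominating function for the density and for its step approximations. -/
noncomputable def densityBound (a b β₁ β₂ : ℝ) (s : ℝ) : ℝ :=
  (((s - a) / 2) ^ β₁ + (b - a) ^ β₁) * (((b - s) / 2) ^ β₂ + (b - a) ^ β₂)

lemma densityBound_nonneg {a b β₁ β₂ s : ℝ} (hs : s ∈ Ioo a b) :
    0 ≤ densityBound a b β₁ β₂ s := by
  have h₁ : 0 < s - a := sub_pos.2 hs.1
  have h₂ : 0 < b - s := sub_pos.2 hs.2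
  have h₃ : 0 < b - a := by linarith
  unfold densityBound
  positivity

lemma integrableOn_densityBound {a b β₁ β₂ : ℝ} (hab : a < b) (hβ₁ : -1 < β₁)
    (hβ₂ : -1 < β₂) : IntegrableOn (densityBound a b β₁ β₂) (Ioo a b) := by
  have hpow : ∀ {β : ℝ}, -1 < β →
      IntervalIntegrable (fun x : ℝ => x ^ β) volume 0 ((b - a) / 2) :=
    fun hβ => intervalIntegral.intervalIntegrable_rpow' hβ
  refine integrableOn_mul_of_singular_endpoints hab ?_ ?_ ?_ ?_
  · refine Integrable.add ?_ (integrableOn_const (by simp))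
    have h := ((hpow hβ₁).comp_mul_right (c := 1 / 2)).comp_sub_right a
    refine (intervalIntegrable_iff_integrableOn_Ioo_of_le hab.le).1 ?_
    convert h using 1
    · ext s; congr 1; ring
    · ring
    · ring
  · refine Integrable.add ?_ (integrableOn_const (by simp))
    have h := ((hpow hβ₂).comp_mul_right (c := 1 / 2)).comp_sub_left b
    refine (intervalIntegrable_iff_integrableOn_Ioo_of_le hab.le).1 ?_
    convert h.symm using 1
    · ext s; congr 1; ring
    · ring
    · ring
  · refine ContinuousOn.add (ContinuousOn.rpow_const (by fun_prop) fun s hs => Or.inl ?_)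
      continuousOn_const
    have : 0 < s - a := sub_pos.2 hs
    positivity
  · refine ContinuousOn.add (ContinuousOn.rpow_const (by fun_prop) fun s hs => Or.inl ?_)
      continuousOn_const
    have : 0 < b - s := sub_pos.2 hs
    positivity

lemma abs_reflectionDensity_le {a b β₁ β₂ M s t : ℝ} {g : ℝ → ℝ}
    (hM : ∀ x ∈ Icc a b, |g x| ≤ M) (hs : s ∈ Ioo a b) (ht : t ∈ Ioo a b)
    (h₁ : (s - a) / 2 ≤ t - a) (h₂ : (b - s) / 2 ≤ b - t) :
    |reflectionDensity a b β₁ β₂ g t| ≤ densityBound a b β₁ β₂ s * M := by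
  have hta : 0 < t - a := sub_pos.2 ht.1
  have htb : 0 < b - t := sub_pos.2 ht.2
  have hsa : 0 < s - a := sub_pos.2 hs.1
  have hsb : 0 < b - s := sub_pos.2 hs.2
  have hba : 0 < b - a := by linarith
  rw [reflectionDensity, abs_mul, abs_of_nonneg (by positivity : 0 ≤ (t - a) ^ β₁ * (b - t) ^ β₂)]
  refine mul_le_mul ?_ (hM t (Ioo_subset_Icc_self ht)) (abs_nonneg _) (densityBound_nonneg hs)
  exact mul_le_mul (rpow_le_rpow_add_rpow β₁ (by positivity) h₁ (by linarith))
    (rpow_le_rpow_add_rpow β₂ (by positivity) h₂ (by linarith)) (by positivity) (by positivity)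

lemma continuousOn_reflectionDensity {a b β₁ β₂ : ℝ} {g : ℝ → ℝ}
    (hg : ContinuousOn g (Icc a b)) :
    ContinuousOn (reflectionDensity a b β₁ β₂ g) (Ioo a b) :=
  ((ContinuousOn.rpow_const (by fun_prop) fun _ hs => Or.inl (sub_pos.2 hs.1).ne').mul
    (ContinuousOn.rpow_const (by fun_prop) fun _ hs => Or.inl (sub_pos.2 hs.2).ne')).mul
    (hg.mono Ioo_subset_Icc_self)

/-- Right-endpoint sums over the interior nodes of a uniform grid converge to the integral of a
function continuous on `(a, b)`, provided the associated step functions are dominated. -/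
lemma tendsto_sum_interior_nodes {a b : ℝ} (hab : a < b) {f D : ℝ → ℝ}
    (hf : ContinuousOn f (Ioo a b)) (hD : IntegrableOn D (Ioo a b))
    (hbound : ∀ n : ℕ, ∀ s ∈ Ioo a b,
      |(Ioo a b).indicator f (ceilNode a ((b - a) / (n + 1)) s)| ≤ D s) :
    Tendsto
      (fun n : ℕ => (b - a) / ((n : ℝ) + 1) *
        ∑ j ∈ Finset.Icc 1 n, f (a + j * (b - a) / ((n : ℝ) + 1)))
      atTop (nhds (∫ s in Ioo a b, f s)) := by
  have hba : 0 < b - a := sub_pos.2 hab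
  have hδ : ∀ n : ℕ, 0 < (b - a) / ((n : ℝ) + 1) := fun n => by positivity
  have hend : ∀ n : ℕ, a + ((n + 1 : ℕ) : ℝ) * ((b - a) / ((n : ℝ) + 1)) = b := fun n => by
    push_cast; field_simp; ring
  have hlim : Tendsto (fun n : ℕ => (b - a) / ((n : ℝ) + 1)) atTop (nhds 0) :=
    tendsto_const_nhds.div_atTop (tendsto_natCast_atTop_atTop.atTop_add tendsto_const_nhds)
  have hint := fun n : ℕ =>
    intervalIntegrable_comp_ceilNode ((Ioo a b).indicator f) (a := a) (hδ n) (n + 1)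
  have hsum := fun n : ℕ =>
    integral_comp_ceilNode ((Ioo a b).indicator f) (a := a) (hδ n) (n + 1)
  simp only [hend] at hint hsum
  have hmain : Tendsto
      (fun n : ℕ => ∫ s in Ioo a b, (Ioo a b).indicator f (ceilNode a ((b - a) / (n + 1)) s))
      atTop (nhds (∫ s in Ioo a b, f s)) := by
    refine tendsto_integral_of_dominated_convergence D
      (fun n => ((intervalIntegrable_iff_integrableOn_Ioo_of_le hab.le).1
        (hint n)).aestronglyMeasurable) hD
      (fun n => ae_restrict_of_forall_mem measurableSet_Ioo (hbound n))
      (ae_restrict_of_forall_mem measurableSet_Ioo fun s hs => ?_)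
    have hcont : ContinuousAt ((Ioo a b).indicator f) s := by
      have hnhds := isOpen_Ioo.mem_nhds hs
      refine (hf.continuousAt hnhds).congr ?_
      filter_upwards [hnhds] with x hx
      rw [indicator_of_mem hx]
    have := hcont.tendsto.comp (tendsto_ceilNode hs.1.le hδ hlim)
    rwa [indicator_of_mem hs] at this
  refine hmain.congr fun n => ?_
  rw [← integral_Ioc_eq_integral_Ioo, ← intervalIntegral.integral_of_le hab.le, hsum,
    Finset.sum_range_succ, hend, indicator_of_notMem (by simp), add_zero,
    Finset.range_eq_Ico, Finset.sum_Ico_add' (fun j : ℕ =>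
      (Ioo a b).indicator f (a + (j : ℝ) * ((b - a) / ((n : ℝ) + 1)))) 0 n 1]
  congr 1
  refine Finset.sum_congr (by ext; simp) fun j hj => ?_
  rw [mul_div_assoc, indicator_of_mem]
  rw [Finset.mem_Icc] at hj
  have hj₀ : (0 : ℝ) < j := by exact_mod_cast hj.1
  have hj₁ : (j : ℝ) < (n + 1 : ℕ) := by exact_mod_cast Nat.lt_succ_of_le hj.2
  refine ⟨by linarith [mul_pos hj₀ (hδ n)], ?_⟩
  have := mul_lt_mul_of_pos_right hj₁ (hδ n)
  linarith [hend n]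

theorem riemann_sums_converge_to_improper_integral
    (a b β₁ β₂ : ℝ) (g : ℝ → ℝ)
    (hab : a < b) (hβ₁ : -1 < β₁) (hβ₂ : -1 < β₂)
    (hg : ContinuousOn g (Icc a b)) :
    IntegrableOn (reflectionDensity a b β₁ β₂ g) (Ioo a b) ∧
    Tendsto
      (fun N : ℕ =>
        (b - a) / (N : ℝ) *
          ∑ j ∈ Finset.Icc 1 N,
            reflectionDensity a b β₁ β₂ g (a + j * (b - a) / ((N : ℝ) + 1)))
      atTop
      (nhds (∫ s in Ioo a b, reflectionDensity a b β₁ β₂ g s)) := by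
  have hba : 0 < b - a := sub_pos.2 hab
  obtain ⟨M, hM⟩ := isCompact_Icc.exists_bound_of_continuousOn hg
  simp only [Real.norm_eq_abs] at hM
  have hM₀ : 0 ≤ M := (abs_nonneg _).trans (hM a (left_mem_Icc.2 hab.le))
  have hcont := continuousOn_reflectionDensity (β₁ := β₁) (β₂ := β₂) hg
  have hD : IntegrableOn (fun s => densityBound a b β₁ β₂ s * M) (Ioo a b) :=
    (integrableOn_densityBound hab hβ₁ hβ₂).mul_const M
  refine ⟨hD.mono' (hcont.aestronglyMeasurable measurableSet_Ioo)
    (ae_restrict_of_forall_mem measurableSet_Ioo fun s hs => abs_reflectionDensity_le hM hs hs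
      (by linarith [hs.1]) (by linarith [hs.2])), ?_⟩
  have hsum := tendsto_sum_interior_nodes hab hcont hD fun n s hs => by
    have hδ : 0 < (b - a) / ((n : ℝ) + 1) := by positivity
    by_cases ht : ceilNode a ((b - a) / ((n : ℝ) + 1)) s ∈ Ioo a b
    · rw [indicator_of_mem ht]
      have hle := le_ceilNode (a := a) (s := s) hδ
      have hlt := ceilNode_lt hδ hs.1.le
      have hsub := ceilNode_le_sub hδ n (by push_cast; field_simp; ring) ht.2
      exact abs_reflectionDensity_le hM hs ht (by linarith [hs.1]) (by linarith)
    · rw [indicator_of_notMem ht, abs_zero]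
      exact mul_nonneg (densityBound_nonneg hs) hM₀
  have hratio : Tendsto (fun n : ℕ => ((n : ℝ) + 1) / n) atTop (nhds 1) := by
    have := (tendsto_natCast_div_add_atTop (1 : ℝ)).inv₀ one_ne_zero
    simpa using this
  have hprod := hratio.mul hsum
  rw [one_mul] at hprod
  refine hprod.congr fun n => ?_
  rw [← mul_assoc]
  congr 1
  field_simp
end

section
/- Let a < b be real numbers, let β₁, β₂ > −1, and let g : [a, b] → ℝ be continuous. Define h(s) = (s−a)^{β₁} (b−s)^{β₂} g(s) for s ∈ (a, b), and for each positive integer N set λ_j^N = a + j(b−a)/(N+1) for j = 1, …, N. Then for every complex number λ ∉ [a, b], the sums ((b−a)/(2πN)) · Σ_{j=1}^{N} h(λ_j^N)/(λ − λ_j^N) converge, as N → ∞, to (1/(2π)) ∫_a^b h(s)/(λ − s) ds. -/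
open MeasureTheory Set Filter

theorem integrableOn_rpow_mul_one_sub_rpow {p q : ℝ} (hp : -1 < p) (hq : -1 < q) :
    IntegrableOn (fun t : ℝ => t ^ p * (1 - t) ^ q) (Ioo 0 1) := by
  have h := Complex.betaIntegral_convergent (u := ((p + 1 : ℝ) : ℂ)) (v := ((q + 1 : ℝ) : ℂ))
    (by simpa using by linarith) (by simpa using by linarith)
  rw [intervalIntegrable_iff_integrableOn_Ioo_of_le zero_le_one] at h
  refine IntegrableOn.congr_fun h.norm (fun t ht => ?_) measurableSet_Ioo
  have h1 : (0 : ℝ) < 1 - t := sub_pos.2 ht.2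
  have e : (1 - (t : ℂ)) = ((1 - t : ℝ) : ℂ) := by push_cast; rfl
  simp only [norm_mul]
  rw [e, Complex.norm_cpow_eq_rpow_re_of_pos ht.1, Complex.norm_cpow_eq_rpow_re_of_pos h1]
  simp

theorem integral_comp_natFloor (c : ℕ → ℂ) (N : ℕ) :
    ∫ x in (0 : ℝ)..N, c ⌊x⌋₊ = ∑ k ∈ Finset.range N, c k := by
  have hcell : ∀ k : ℕ, EqOn (fun _ : ℝ => c k) (fun x : ℝ => c ⌊x⌋₊)
      (Ico (k : ℝ) ((k + 1 : ℕ) : ℝ)) := fun k x hx => by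
    have : ⌊x⌋₊ = k := (Nat.floor_eq_iff (k.cast_nonneg.trans hx.1)).2 ⟨hx.1, by simpa using hx.2⟩
    simp [this]
  have hle : ∀ k : ℕ, (k : ℝ) ≤ ((k + 1 : ℕ) : ℝ) := fun k => by simp
  have hint : ∀ k < N, IntervalIntegrable (fun x : ℝ => c ⌊x⌋₊) volume (k : ℝ) ((k + 1 : ℕ) : ℝ) :=
    fun k _ => (intervalIntegrable_iff_integrableOn_Ico_of_le (hle k)).2
      (IntegrableOn.congr_fun (by simp) (hcell k) measurableSet_Ico)
  have hsum := intervalIntegral.sum_integral_adjacent_intervals hint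
  rw [Nat.cast_zero] at hsum
  rw [← hsum]
  refine Finset.sum_congr rfl fun k _ => ?_
  rw [intervalIntegral.integral_of_le (hle k), ← integral_Ico_eq_integral_Ioc,
    ← setIntegral_congr_fun measurableSet_Ico (hcell k)]
  simp

/-- The interior sample sum is the integral of a step function whose cells have length `1 / N`. -/
theorem inv_mul_sum_Icc_eq_setIntegral (f : ℝ → ℂ) {N : ℕ} (hN : N ≠ 0) :
    (N : ℂ)⁻¹ * ∑ j ∈ Finset.Icc 1 N, f (j / ((N : ℝ) + 1)) =
      ∫ t in Ioo (0 : ℝ) 1, f ((⌊t * N⌋₊ + 1) / ((N : ℝ) + 1)) := by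
  have hN' : (N : ℝ) ≠ 0 := Nat.cast_ne_zero.2 hN
  rw [← integral_Ioc_eq_integral_Ioo, ← intervalIntegral.integral_of_le zero_le_one,
    intervalIntegral.integral_comp_mul_right
      (fun x : ℝ => f ((⌊x⌋₊ + 1) / ((N : ℝ) + 1))) hN', zero_mul, one_mul,
    integral_comp_natFloor (fun k => f ((k + 1) / ((N : ℝ) + 1))),
    Finset.range_eq_Ico, ← Finset.Ico_succ_right_eq_Icc, Nat.succ_eq_succ,
    Finset.sum_Ico_eq_sum_range, Finset.sum_Ico_eq_sum_range]
  simp [add_comm]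

theorem floor_sample_bounds {t : ℝ} (ht : t ∈ Ioo (0 : ℝ) 1) {N : ℕ} (hN : N ≠ 0) :
    t / 2 ≤ (⌊t * N⌋₊ + 1) / ((N : ℝ) + 1) ∧
      (1 - t) / 2 ≤ 1 - (⌊t * N⌋₊ + 1) / ((N : ℝ) + 1) := by
  have h1 : (1 : ℝ) ≤ N := by exact_mod_cast Nat.one_le_iff_ne_zero.2 hN
  have hl := Nat.lt_floor_add_one (t * N)
  have hu := Nat.floor_le (a := t * N) (mul_nonneg ht.1.le N.cast_nonneg)
  have hpos : (0 : ℝ) < N + 1 := by positivity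
  refine ⟨?_, ?_⟩
  · rw [le_div_iff₀ hpos]
    nlinarith [ht.1, ht.2]
  · rw [le_sub_comm, div_le_iff₀ hpos]
    nlinarith [ht.1, ht.2]

theorem tendsto_floor_sample {t : ℝ} (ht : 0 ≤ t) :
    Tendsto (fun N : ℕ => ((⌊t * N⌋₊ : ℝ) + 1) / ((N : ℝ) + 1)) atTop (nhds t) := by
  have h1 : Tendsto (fun N : ℕ => (⌊t * N⌋₊ : ℝ) / N) atTop (nhds t) :=
    (tendsto_nat_floor_mul_div_atTop ht).comp tendsto_natCast_atTop_atTop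
  have h2 := tendsto_natCast_div_add_atTop (1 : ℝ)
  have h3 := tendsto_one_div_add_atTop_nhds_zero_nat (𝕜 := ℝ)
  have h := (h1.mul h2).add h3
  rw [mul_one, add_zero] at h
  refine h.congr' ?_
  filter_upwards [eventually_ne_atTop 0] with N hN
  have : (N : ℝ) ≠ 0 := Nat.cast_ne_zero.2 hN
  field_simp

/-- Riemann sums over interior equispaced nodes converge for integrands dominated by an integrable
product of nonincreasing endpoint powers. -/
theorem tendsto_inv_mul_sum_of_norm_le_rpow {f : ℝ → ℂ} {C p q : ℝ}
    (hp : -1 < p) (hp0 : p ≤ 0) (hq : -1 < q) (hq0 : q ≤ 0) (hC : 0 ≤ C)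
    (hf : ContinuousOn f (Ioo 0 1))
    (hbound : ∀ t ∈ Ioo (0 : ℝ) 1, ‖f t‖ ≤ C * (t ^ p * (1 - t) ^ q)) :
    Tendsto (fun N : ℕ => (N : ℂ)⁻¹ * ∑ j ∈ Finset.Icc 1 N, f (j / ((N : ℝ) + 1))) atTop
      (nhds (∫ t in Ioo (0 : ℝ) 1, f t)) := by
  have key : Tendsto (fun N : ℕ => ∫ t in Ioo (0 : ℝ) 1, f ((⌊t * N⌋₊ + 1) / ((N : ℝ) + 1))) atTop
      (nhds (∫ t in Ioo (0 : ℝ) 1, f t)) := by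
    refine tendsto_integral_filter_of_dominated_convergence
      (fun t : ℝ => C * ((1 / 2) ^ p * (1 / 2) ^ q) * (t ^ p * (1 - t) ^ q)) ?_ ?_
      ((integrableOn_rpow_mul_one_sub_rpow hp hq).const_mul _) ?_
    · refine Eventually.of_forall fun N => Measurable.aestronglyMeasurable ?_
      exact (measurable_from_top (f := fun k : ℕ => f ((k + 1) / ((N : ℝ) + 1)))).comp
        (Nat.measurable_floor.comp (measurable_id.mul_const _))
    · filter_upwards [eventually_ne_atTop 0] with N hN
      refine ae_restrict_of_forall_mem measurableSet_Ioo fun t ht => ?_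
      obtain ⟨hl, hr⟩ := floor_sample_bounds ht hN
      have ht0 : 0 < t := ht.1
      have ht1 : 0 < 1 - t := sub_pos.2 ht.2
      refine (hbound _ ⟨by linarith, by linarith⟩).trans ?_
      rw [mul_assoc, mul_mul_mul_comm, ← Real.mul_rpow (by norm_num) ht0.le,
        ← Real.mul_rpow (by norm_num) ht1.le]
      refine mul_le_mul_of_nonneg_left (mul_le_mul ?_ ?_ ?_ (by positivity)) hC
      · exact Real.rpow_le_rpow_of_nonpos (by positivity) (by linarith) hp0
      · exact Real.rpow_le_rpow_of_nonpos (by positivity) (by linarith) hq0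
      · exact Real.rpow_nonneg (by linarith) _
    · refine ae_restrict_of_forall_mem measurableSet_Ioo fun t ht => ?_
      exact (hf.continuousAt (isOpen_Ioo.mem_nhds ht)).tendsto.comp (tendsto_floor_sample ht.1.le)
  refine key.congr' ?_
  filter_upwards [eventually_ne_atTop 0] with N hN
  exact (inv_mul_sum_Icc_eq_setIntegral f hN).symm

theorem tendsto_inv_mul_sum_rpow_mul {G : ℝ → ℂ} {p q : ℝ} (hp : -1 < p) (hq : -1 < q)
    (hG : ContinuousOn G (Icc 0 1)) :
    Tendsto (fun N : ℕ => (N : ℂ)⁻¹ * ∑ j ∈ Finset.Icc 1 N,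
        (((j / ((N : ℝ) + 1)) ^ p * (1 - j / ((N : ℝ) + 1)) ^ q : ℝ) : ℂ) * G (j / ((N : ℝ) + 1)))
      atTop (nhds (∫ t in Ioo (0 : ℝ) 1, ((t ^ p * (1 - t) ^ q : ℝ) : ℂ) * G t)) := by
  obtain ⟨C, hC⟩ := isCompact_Icc.exists_bound_of_continuousOn hG
  have hC0 : 0 ≤ C := (norm_nonneg _).trans (hC 0 (by simp))
  refine tendsto_inv_mul_sum_of_norm_le_rpow
    (f := fun t => ((t ^ p * (1 - t) ^ q : ℝ) : ℂ) * G t) (C := C) (p := min p 0) (q := min q 0)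
    (lt_min hp (by norm_num)) (min_le_right _ _) (lt_min hq (by norm_num)) (min_le_right _ _)
    hC0 ?_ fun t ht => ?_
  · refine ContinuousOn.mul (Complex.continuous_ofReal.comp_continuousOn ?_)
      (hG.mono Ioo_subset_Icc_self)
    refine (continuousOn_id.rpow_const fun t ht => Or.inl ht.1.ne').mul ?_
    exact (continuousOn_const.sub continuousOn_id).rpow_const
      fun t ht => Or.inl (sub_pos.2 ht.2).ne'
  · have ht0 : 0 < t := ht.1
    have ht1 : 0 < 1 - t := sub_pos.2 ht.2
    rw [norm_mul, Complex.norm_real, Real.norm_of_nonneg (by positivity), mul_comm]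
    refine mul_le_mul (hC t (Ioo_subset_Icc_self ht)) (mul_le_mul ?_ ?_ ?_ ?_) ?_ hC0
    · exact Real.rpow_le_rpow_of_exponent_ge ht0 ht.2.le (min_le_left _ _)
    · exact Real.rpow_le_rpow_of_exponent_ge ht1 (by linarith) (min_le_left _ _)
    all_goals positivity

theorem reflectionDensity_affine {a b : ℝ} (hab : a < b) (β₁ β₂ : ℝ) (g : ℝ → ℝ) {t : ℝ}
    (ht : t ∈ Icc (0 : ℝ) 1) :
    reflectionDensity a b β₁ β₂ g (a + t * (b - a)) =
      t ^ β₁ * (1 - t) ^ β₂ * ((b - a) ^ β₁ * (b - a) ^ β₂ * g (a + t * (b - a))) := by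
  have hba : 0 ≤ b - a := (sub_pos.2 hab).le
  rw [reflectionDensity, show a + t * (b - a) - a = t * (b - a) by ring,
    show b - (a + t * (b - a)) = (1 - t) * (b - a) by ring, Real.mul_rpow ht.1 hba,
    Real.mul_rpow (sub_nonneg.2 ht.2) hba]
  ring

theorem setIntegral_Ioo_eq_affine {a b : ℝ} (hab : a < b) (F : ℝ → ℂ) :
    ∫ s in Ioo a b, F s = ((b - a : ℝ) : ℂ) * ∫ t in Ioo (0 : ℝ) 1, F (a + t * (b - a)) := by
  rw [← integral_Ioc_eq_integral_Ioo, ← integral_Ioc_eq_integral_Ioo,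
    ← intervalIntegral.integral_of_le hab.le, ← intervalIntegral.integral_of_le zero_le_one]
  have h := intervalIntegral.smul_integral_comp_add_mul (a := 0) (b := 1) F (b - a) a
  simp only [mul_zero, add_zero, mul_one, add_sub_cancel] at h
  rw [← h, Complex.real_smul]
  simp only [mul_comm]

theorem cauchy_kernel_sums_converge_pointwise
    (a b β₁ β₂ : ℝ) (g : ℝ → ℝ)
    (hab : a < b) (hβ₁ : -1 < β₁) (hβ₂ : -1 < β₂)
    (hg : ContinuousOn g (Icc a b)) :
    ∀ z : ℂ, z ∉ (fun s : ℝ => (s : ℂ)) '' Icc a b →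
      Tendsto
        (fun N : ℕ =>
          (((b - a) / (2 * Real.pi * N) : ℝ) : ℂ) *
            ∑ j ∈ Finset.Icc 1 N,
              (reflectionDensity a b β₁ β₂ g (a + j * (b - a) / ((N : ℝ) + 1)) : ℂ) /
                (z - ((a + j * (b - a) / ((N : ℝ) + 1) : ℝ) : ℂ)))
        atTop
        (nhds (((1 / (2 * Real.pi) : ℝ) : ℂ) *
          ∫ s in Ioo a b, (reflectionDensity a b β₁ β₂ g s : ℂ) / (z - (s : ℂ)))) := by
  intro z hz
  have hba : 0 < b - a := sub_pos.2 hab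
  have hmem : ∀ t ∈ Icc (0 : ℝ) 1, a + t * (b - a) ∈ Icc a b := fun t ht =>
    ⟨by nlinarith [ht.1], by nlinarith [ht.2]⟩
  set G : ℝ → ℂ := fun t => (((b - a) ^ β₁ * (b - a) ^ β₂ * g (a + t * (b - a)) : ℝ) : ℂ) /
    (z - ((a + t * (b - a) : ℝ) : ℂ)) with hG_def
  have hfactor : ∀ t ∈ Icc (0 : ℝ) 1,
      (reflectionDensity a b β₁ β₂ g (a + t * (b - a)) : ℂ) / (z - ((a + t * (b - a) : ℝ) : ℂ)) =
        ((t ^ β₁ * (1 - t) ^ β₂ : ℝ) : ℂ) * G t := fun t ht => by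
    rw [reflectionDensity_affine hab β₁ β₂ g ht, hG_def, Complex.ofReal_mul, mul_div_assoc]
  have hG : ContinuousOn G (Icc 0 1) := by
    refine ContinuousOn.div (Complex.continuous_ofReal.comp_continuousOn
      (continuousOn_const.mul (hg.comp (by fun_prop) hmem))) (by fun_prop) fun t ht h => ?_
    exact hz ⟨_, hmem t ht, (sub_eq_zero.1 h).symm⟩
  have key := (tendsto_inv_mul_sum_rpow_mul hβ₁ hβ₂ hG).const_mul
    (((1 / (2 * Real.pi) : ℝ) : ℂ) * ((b - a : ℝ) : ℂ))
  rw [setIntegral_Ioo_eq_affine hab, setIntegral_congr_fun measurableSet_Ioo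
    (fun t ht => hfactor t (Ioo_subset_Icc_self ht)), ← mul_assoc]
  refine key.congr fun N => ?_
  rw [← mul_assoc]
  congr 1
  · push_cast
    ring
  · refine Finset.sum_congr rfl fun j hj => ?_
    have hN : (0 : ℝ) < (N : ℝ) + 1 := by positivity
    have hjN : (j : ℝ) ≤ N := by exact_mod_cast (Finset.mem_Icc.1 hj).2
    have hj01 : (j : ℝ) / ((N : ℝ) + 1) ∈ Icc (0 : ℝ) 1 :=
      ⟨by positivity, (div_le_one hN).2 (by linarith)⟩
    rw [← hfactor _ hj01, div_mul_eq_mul_div]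
end

section
/- Let 0 < η₁ < η₀ < η₂, let β₀, β₁, β₂ > −1, let γ : [η₁, η₂] → ℝ be continuous and strictly positive, and set r₀(λ) = (λ−η₁)^{β₁} (η₂−λ)^{β₂} |λ−η₀|^{β₀} γ(λ). For positive integers N₁, N₂ set λ_{1,j} = η₁ + j(η₀−η₁)/(N₁+1) for j = 1,…,N₁ and λ_{2,j} = η₀ + j(η₂−η₀)/(N₂+1) for j = 1,…,N₂. Then for every λ ∈ ℂ ∖ [η₁, η₂]: Σ_{j=1}^{N₁} (η₀−η₁) r₀(λ_{1,j}) / (2N₁π (λ − λ_{1,j})) → (1/(2π)) ∫_{η₁}^{η₀} r₀(s)/(λ − s) ds as N₁ → ∞, and Σ_{j=1}^{N₂} (η₂−η₀) r₀(λ_{2,j}) / (2N₂π (λ − λ_{2,j})) → (1/(2π)) ∫_{η₀}^{η₂} r₀(s)/(λ − s) ds as N₂ → ∞. -/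
open MeasureTheory Set Filter

/-- The first generalized reflection coefficient
`r₀(λ) = (λ-η₁)^{β₁} (η₂-λ)^{β₂} |λ-η₀|^{β₀} γ(λ)`. -/
noncomputable def r0 (η₁ η₀ η₂ β₀ β₁ β₂ : ℝ) (γ : ℝ → ℝ) (l : ℝ) : ℝ :=
  (l - η₁) ^ β₁ * (η₂ - l) ^ β₂ * |l - η₀| ^ β₀ * γ l

/-- The Jacobi weight `(s - a) ^ p * (b - s) ^ q` is integrable on `(a, b)` when `p, q > -1`. -/
theorem integrableOn_rpow_mul_rpow {a b p q : ℝ} (hab : a < b) (hp : -1 < p) (hq : -1 < q) :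
    IntegrableOn (fun s : ℝ => (s - a) ^ p * (b - s) ^ q) (Ioo a b) := by
  obtain ⟨m, ham, hmb⟩ := exists_between hab
  have left : IntervalIntegrable (fun s : ℝ => (s - a) ^ p * (b - s) ^ q) volume a m := by
    apply IntervalIntegrable.mul_continuousOn
    · simpa using (intervalIntegral.intervalIntegrable_rpow' (a := 0) (b := m - a) hp).comp_sub_right a
    · rw [uIcc_of_le ham.le]
      exact ContinuousOn.rpow_const (by fun_prop)
        fun x hx => Or.inl (sub_pos.2 (hx.2.trans_lt hmb)).ne'
  have right : IntervalIntegrable (fun s : ℝ => (s - a) ^ p * (b - s) ^ q) volume m b := by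
    apply IntervalIntegrable.continuousOn_mul
    · simpa using (intervalIntegral.intervalIntegrable_rpow' (a := b - m) (b := 0) hq).comp_sub_left b
    · rw [uIcc_of_le hmb.le]
      exact ContinuousOn.rpow_const (by fun_prop)
        fun x hx => Or.inl (sub_pos.2 (ham.trans_le hx.1)).ne'
  exact (intervalIntegrable_iff_integrableOn_Ioo_of_le hab.le).1 (left.trans right)

/-- The step function taking the value `F (a + j * h)` on `[a + j * h, a + (j + 1) * h)` for
`1 ≤ j ≤ N`, and zero elsewhere. -/
noncomputable def stepApprox (a h : ℝ) (F : ℝ → ℂ) (N : ℕ) (s : ℝ) : ℂ :=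
  ∑ j ∈ Finset.Icc 1 N,
    (Ico (a + j * h) (a + (j + 1) * h)).indicator (fun _ => F (a + j * h)) s

theorem stepApprox_eq {a h s : ℝ} {F : ℝ → ℂ} {N j : ℕ} (hh : 0 < h) (hj : j ∈ Finset.Icc 1 N)
    (hs : s ∈ Ico (a + j * h) (a + (j + 1) * h)) :
    stepApprox a h F N s = F (a + j * h) := by
  unfold stepApprox
  rw [Finset.sum_eq_single_of_mem j hj, indicator_of_mem hs]
  intro i _ hij
  apply indicator_of_notMem
  rintro ⟨h1, h2⟩
  have h3 : (i : ℝ) < j + 1 := lt_of_mul_lt_mul_right (by linarith [hs.2]) hh.le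
  have h4 : (j : ℝ) < i + 1 := lt_of_mul_lt_mul_right (by linarith [hs.1]) hh.le
  norm_cast at h3 h4
  omega

theorem stepApprox_eq_zero {a h s : ℝ} {F : ℝ → ℂ} {N : ℕ} (hh : 0 < h) (hs : s < a + h) :
    stepApprox a h F N s = 0 := by
  apply Finset.sum_eq_zero
  intro j hj
  apply indicator_of_notMem
  rintro ⟨h1, -⟩
  have : (1 : ℝ) ≤ j := by exact_mod_cast (Finset.mem_Icc.1 hj).1
  nlinarith

/-- Every point of `(a, b)` beyond the first cell lies in one of the cells of `stepApprox`. -/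
theorem exists_mem_cell {a b s : ℝ} {N : ℕ} (hab : a < b) (hs : s < b)
    (hs' : a + (b - a) / (N + 1) ≤ s) :
    ∃ j ∈ Finset.Icc 1 N,
      s ∈ Ico (a + j * ((b - a) / (N + 1))) (a + (j + 1) * ((b - a) / (N + 1))) := by
  have hN : (0 : ℝ) < N + 1 := by positivity
  have hh : 0 < (b - a) / (N + 1) := div_pos (sub_pos.2 hab) hN
  have hNh : (N + 1) * ((b - a) / (N + 1)) = b - a := by field_simp
  set h := (b - a) / (N + 1) with hdef
  have h1 : 1 ≤ (s - a) / h := by rw [le_div_iff₀ hh]; linarith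
  have h2 : (s - a) / h < (N + 1 : ℕ) := by
    rw [div_lt_iff₀ hh]; push_cast; linarith
  have h3 := Nat.floor_le (zero_le_one.trans h1)
  have h4 := Nat.lt_floor_add_one ((s - a) / h)
  rw [le_div_iff₀ hh] at h3
  rw [div_lt_iff₀ hh] at h4
  refine ⟨⌊(s - a) / h⌋₊, Finset.mem_Icc.2 ⟨Nat.le_floor (by simpa using h1), ?_⟩, ?_, ?_⟩
  · exact Nat.lt_succ_iff.1 ((Nat.floor_lt (zero_le_one.trans h1)).2 h2)
  · linarith
  · linarith

theorem integral_stepApprox {a b : ℝ} {F : ℝ → ℂ} {N : ℕ} (hab : a < b) :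
    ∫ s in Ioo a b, stepApprox a ((b - a) / (N + 1)) F N s =
      ∑ j ∈ Finset.Icc 1 N,
        (((b - a) / (N + 1) : ℝ) : ℂ) * F (a + j * ((b - a) / (N + 1))) := by
  have hN : (0 : ℝ) < N + 1 := by positivity
  have hh : 0 < (b - a) / (N + 1) := div_pos (sub_pos.2 hab) hN
  have hNh : (N + 1) * ((b - a) / (N + 1)) = b - a := by field_simp
  set h := (b - a) / (N + 1) with hdef
  unfold stepApprox
  rw [integral_finsetSum]
  · refine Finset.sum_congr rfl fun j hj => ?_
    have hj1 : (1 : ℝ) ≤ j := by exact_mod_cast (Finset.mem_Icc.1 hj).1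
    have hj2 : (j : ℝ) ≤ N := by exact_mod_cast (Finset.mem_Icc.1 hj).2
    rw [integral_indicator_const _ measurableSet_Ico]
    have hsub : Ico (a + j * h) (a + (j + 1) * h) ⊆ Ioo a b := by
      intro x hx
      exact ⟨by nlinarith [hx.1], by nlinarith [hx.2]⟩
    rw [measureReal_restrict_apply measurableSet_Ico, inter_eq_left.2 hsub,
      Real.volume_real_Ico_of_le (by nlinarith), Complex.real_smul]
    congr 2
    ring
  · intro j _
    exact (integrable_const _).indicator measurableSet_Ico

theorem measurable_stepApprox {a h : ℝ} {F : ℝ → ℂ} {N : ℕ} : Measurable (stepApprox a h F N) := by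
  unfold stepApprox
  exact Finset.measurable_fun_sum _ fun j _ => measurable_const.indicator measurableSet_Ico

theorem tendsto_stepApprox {a b s : ℝ} {F : ℝ → ℂ} (hs : s ∈ Ioo a b) (hF : ContinuousAt F s) :
    Tendsto (fun N : ℕ => stepApprox a ((b - a) / (N + 1)) F N s) atTop (nhds (F s)) := by
  have hab : a < b := hs.1.trans hs.2
  have hlim : Tendsto (fun N : ℕ => (b - a) / ((N : ℝ) + 1)) atTop (nhds 0) :=
    tendsto_const_nhds.div_atTop (tendsto_natCast_atTop_atTop.atTop_add tendsto_const_nhds)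
  rw [Metric.tendsto_atTop]
  intro ε hε
  obtain ⟨δ, hδ, H⟩ := Metric.continuousAt_iff.1 hF ε hε
  rw [← eventually_atTop]
  filter_upwards [hlim.eventually_lt_const hδ, hlim.eventually_lt_const (sub_pos.2 hs.1)]
    with N h1 h2
  obtain ⟨j, hj, hsj⟩ := exists_mem_cell (N := N) hab hs.2 (by linarith)
  have hh : 0 < (b - a) / ((N : ℝ) + 1) := div_pos (sub_pos.2 hab) (by positivity)
  rw [stepApprox_eq hh hj hsj]
  apply H
  rw [Real.dist_eq, abs_lt]
  constructor <;> linarith [hsj.1, hsj.2]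

theorem norm_stepApprox_le {a b p q C s : ℝ} {F : ℝ → ℂ} {N : ℕ} (hp : p ≤ 0) (hq : q ≤ 0)
    (hC : 0 ≤ C) (hF : ∀ s ∈ Ioo a b, ‖F s‖ ≤ C * ((s - a) ^ p * (b - s) ^ q))
    (hs : s ∈ Ioo a b) :
    ‖stepApprox a ((b - a) / (N + 1)) F N s‖ ≤
      C * (1 / 2) ^ p * ((s - a) ^ p * (b - s) ^ q) := by
  have hab : a < b := hs.1.trans hs.2
  have hsa : 0 < s - a := sub_pos.2 hs.1
  have hbs : 0 < b - s := sub_pos.2 hs.2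
  have hh : 0 < (b - a) / ((N : ℝ) + 1) := div_pos (sub_pos.2 hab) (by positivity)
  rcases lt_or_ge s (a + (b - a) / (N + 1)) with h | h
  · rw [stepApprox_eq_zero hh h, norm_zero]
    positivity
  obtain ⟨j, hj, hsj⟩ := exists_mem_cell (N := N) hab hs.2 h
  rw [stepApprox_eq hh hj hsj]
  have hj1 : (1 : ℝ) ≤ j := by exact_mod_cast (Finset.mem_Icc.1 hj).1
  set x := a + j * ((b - a) / (N + 1))
  have hxa : (1 / 2) * (s - a) ≤ x - a := by
    have := hsj.2
    simp only [x]
    nlinarith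
  have hxs : b - s ≤ b - x := by linarith [hsj.1]
  calc ‖F x‖ ≤ C * ((x - a) ^ p * (b - x) ^ q) := hF x ⟨by linarith, by linarith⟩
    _ ≤ C * (((1 / 2) * (s - a)) ^ p * (b - s) ^ q) := by
      have h1 := Real.rpow_le_rpow_of_nonpos (by positivity) hxa hp
      have h2 := Real.rpow_le_rpow_of_nonpos hbs hxs hq
      have : 0 ≤ (b - x) ^ q := Real.rpow_nonneg (by linarith) _
      gcongr
    _ = C * (1 / 2) ^ p * ((s - a) ^ p * (b - s) ^ q) := by
      rw [Real.mul_rpow (by norm_num) hsa.le]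
      ring

/-- Riemann sums on equally spaced interior nodes converge for a function which is continuous on
`(a, b)` and dominated by an integrable Jacobi weight with nonpositive exponents. -/
theorem tendsto_riemann_sum_of_norm_le {a b p q C : ℝ} {F : ℝ → ℂ} (hab : a < b)
    (hp : -1 < p) (hp0 : p ≤ 0) (hq : -1 < q) (hq0 : q ≤ 0) (hC : 0 ≤ C)
    (hFc : ContinuousOn F (Ioo a b))
    (hF : ∀ s ∈ Ioo a b, ‖F s‖ ≤ C * ((s - a) ^ p * (b - s) ^ q)) :
    Tendsto (fun N : ℕ => ∑ j ∈ Finset.Icc 1 N,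
        (((b - a) / N : ℝ) : ℂ) * F (a + j * ((b - a) / (N + 1))))
      atTop (nhds (∫ s in Ioo a b, F s)) := by
  have hlim : Tendsto (fun N : ℕ => ∫ s in Ioo a b, stepApprox a ((b - a) / (N + 1)) F N s)
      atTop (nhds (∫ s in Ioo a b, F s)) := by
    apply tendsto_integral_of_dominated_convergence
      (fun s => C * (1 / 2) ^ p * ((s - a) ^ p * (b - s) ^ q))
    · exact fun N => measurable_stepApprox.aestronglyMeasurable
    · exact (integrableOn_rpow_mul_rpow hab hp hq).const_mul _
    · exact fun N => (ae_restrict_mem measurableSet_Ioo).mono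
        fun s hs => norm_stepApprox_le hp0 hq0 hC hF hs
    · exact (ae_restrict_mem measurableSet_Ioo).mono
        fun s hs => tendsto_stepApprox hs (hFc.continuousAt (isOpen_Ioo.mem_nhds hs))
  have hratio : Tendsto (fun N : ℕ => (((1 + 1 / (N : ℝ)) : ℝ) : ℂ)) atTop (nhds 1) := by
    have := (tendsto_const_div_atTop_nhds_zero_nat (1 : ℝ)).const_add 1
    simpa [Function.comp_def] using (Complex.continuous_ofReal.tendsto _).comp this
  have hmul := hratio.mul hlim
  rw [one_mul] at hmul
  refine hmul.congr' ?_
  filter_upwards [eventually_gt_atTop 0] with N hN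
  rw [integral_stepApprox hab, Finset.mul_sum]
  refine Finset.sum_congr rfl fun j _ => ?_
  rw [← mul_assoc, ← Complex.ofReal_mul]
  congr 2
  have : (0 : ℝ) < N := by exact_mod_cast hN
  field_simp

/-- Riemann sums on equally spaced interior nodes converge for a continuous function times a
Jacobi weight with exponents greater than `-1`. -/
theorem tendsto_riemann_sum_jacobi {a b p q : ℝ} {F φ : ℝ → ℂ} (hab : a < b)
    (hp : -1 < p) (hq : -1 < q) (hφ : ContinuousOn φ (Icc a b))
    (hF : ∀ s ∈ Ioo a b, F s = (((s - a) ^ p * (b - s) ^ q : ℝ) : ℂ) * φ s) :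
    Tendsto (fun N : ℕ => ∑ j ∈ Finset.Icc 1 N,
        (((b - a) / N : ℝ) : ℂ) * F (a + j * ((b - a) / (N + 1))))
      atTop (nhds (∫ s in Ioo a b, F s)) := by
  have hw : ContinuousOn (fun s : ℝ => (s - a) ^ max p 0 * (b - s) ^ max q 0) (Icc a b) :=
    ContinuousOn.mul (ContinuousOn.rpow_const (by fun_prop) fun _ _ => Or.inr (le_max_right _ _))
      (ContinuousOn.rpow_const (by fun_prop) fun _ _ => Or.inr (le_max_right _ _))
  obtain ⟨C, hC⟩ := isCompact_Icc.exists_bound_of_continuousOn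
    ((Complex.continuous_ofReal.comp_continuousOn hw).mul hφ)
  have hC0 : 0 ≤ C := (norm_nonneg _).trans (hC a (left_mem_Icc.2 hab.le))
  refine tendsto_riemann_sum_of_norm_le hab (p := min p 0) (q := min q 0) (C := C)
    (lt_min hp (by norm_num)) (min_le_right _ _) (lt_min hq (by norm_num)) (min_le_right _ _) hC0
    ?_ ?_
  · refine ContinuousOn.congr ?_ hF
    refine (Complex.continuous_ofReal.comp_continuousOn ?_).mul (hφ.mono Ioo_subset_Icc_self)
    exact (ContinuousOn.rpow_const (by fun_prop) fun x hx => Or.inl (sub_pos.2 hx.1).ne').mul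
      (ContinuousOn.rpow_const (by fun_prop) fun x hx => Or.inl (sub_pos.2 hx.2).ne')
  · intro s hs
    have hsa : 0 < s - a := sub_pos.2 hs.1
    have hbs : 0 < b - s := sub_pos.2 hs.2
    have key : F s = (((s - a) ^ min p 0 * (b - s) ^ min q 0 : ℝ) : ℂ) *
        ((((s - a) ^ max p 0 * (b - s) ^ max q 0 : ℝ) : ℂ) * φ s) := by
      rw [hF s hs, ← mul_assoc, ← Complex.ofReal_mul, mul_mul_mul_comm, ← Real.rpow_add hsa,
        ← Real.rpow_add hbs, min_add_max, min_add_max, add_zero, add_zero]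
    rw [key, norm_mul, Complex.norm_of_nonneg (by positivity), mul_comm]
    exact mul_le_mul_of_nonneg_right (hC s (Ioo_subset_Icc_self hs)) (by positivity)

/-- The Cauchy-kernel form of `tendsto_riemann_sum_jacobi`. -/
theorem tendsto_cauchy_sum_jacobi {a b p q : ℝ} {r ψ : ℝ → ℝ} {z : ℂ} (hab : a < b)
    (hp : -1 < p) (hq : -1 < q) (hψ : ContinuousOn ψ (Icc a b))
    (hr : ∀ s ∈ Ioo a b, r s = (s - a) ^ p * (b - s) ^ q * ψ s)
    (hz : ∀ s ∈ Icc a b, z ≠ (s : ℂ)) :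
    Tendsto (fun N : ℕ => ∑ j ∈ Finset.Icc 1 N,
        (((b - a) * r (a + j * (b - a) / ((N : ℝ) + 1)) : ℝ) : ℂ) /
          (((2 * N * Real.pi : ℝ) : ℂ) * (z - ((a + j * (b - a) / ((N : ℝ) + 1) : ℝ) : ℂ))))
      atTop (nhds (((1 / (2 * Real.pi) : ℝ) : ℂ) *
        ∫ s in Ioo a b, (r s : ℂ) / (z - (s : ℂ)))) := by
  have h := tendsto_riemann_sum_jacobi (F := fun s : ℝ => (r s : ℂ) / (z - (s : ℂ)))
    (φ := fun s : ℝ => (ψ s : ℂ) / (z - (s : ℂ))) hab hp hq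
    ((Complex.continuous_ofReal.comp_continuousOn hψ).div (by fun_prop)
      fun s hs => sub_ne_zero.2 (hz s hs))
    (fun s hs => by rw [hr s hs, Complex.ofReal_mul, mul_div_assoc])
  refine (h.const_mul (((1 / (2 * Real.pi) : ℝ) : ℂ))).congr fun N => ?_
  rw [Finset.mul_sum]
  refine Finset.sum_congr rfl fun j _ => ?_
  rw [← mul_div_assoc (j : ℝ)]
  push_cast
  simp only [div_eq_mul_inv, mul_inv]
  ring

theorem cauchy_sums_converge_for_r0
    (η₁ η₀ η₂ β₀ β₁ β₂ : ℝ) (γ : ℝ → ℝ)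
    (hη₁ : 0 < η₁) (h₁₀ : η₁ < η₀) (h₀₂ : η₀ < η₂)
    (hβ₀ : -1 < β₀) (hβ₁ : -1 < β₁) (hβ₂ : -1 < β₂)
    (hγc : ContinuousOn γ (Icc η₁ η₂)) (hγpos : ∀ s ∈ Icc η₁ η₂, 0 < γ s) :
    ∀ z : ℂ, z ∉ (fun s : ℝ => (s : ℂ)) '' Icc η₁ η₂ →
      Tendsto
        (fun N₁ : ℕ =>
          ∑ j ∈ Finset.Icc 1 N₁,
            (((η₀ - η₁) * r0 η₁ η₀ η₂ β₀ β₁ β₂ γ (η₁ + j * (η₀ - η₁) / ((N₁ : ℝ) + 1)) : ℝ) : ℂ) /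
              (((2 * N₁ * Real.pi : ℝ) : ℂ) *
                (z - ((η₁ + j * (η₀ - η₁) / ((N₁ : ℝ) + 1) : ℝ) : ℂ))))
        atTop
        (nhds (((1 / (2 * Real.pi) : ℝ) : ℂ) *
          ∫ s in Ioo η₁ η₀, (r0 η₁ η₀ η₂ β₀ β₁ β₂ γ s : ℂ) / (z - (s : ℂ)))) ∧
      Tendsto
        (fun N₂ : ℕ =>
          ∑ j ∈ Finset.Icc 1 N₂,
            (((η₂ - η₀) * r0 η₁ η₀ η₂ β₀ β₁ β₂ γ (η₀ + j * (η₂ - η₀) / ((N₂ : ℝ) + 1)) : ℝ) : ℂ) /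
              (((2 * N₂ * Real.pi : ℝ) : ℂ) *
                (z - ((η₀ + j * (η₂ - η₀) / ((N₂ : ℝ) + 1) : ℝ) : ℂ))))
        atTop
        (nhds (((1 / (2 * Real.pi) : ℝ) : ℂ) *
          ∫ s in Ioo η₀ η₂, (r0 η₁ η₀ η₂ β₀ β₁ β₂ γ s : ℂ) / (z - (s : ℂ)))) := by
  intro z hz
  have hz' : ∀ s ∈ Icc η₁ η₂, z ≠ (s : ℂ) := fun s hs h => hz ⟨s, hs, h.symm⟩
  constructor
  · refine tendsto_cauchy_sum_jacobi (ψ := fun s => (η₂ - s) ^ β₂ * γ s) h₁₀ hβ₁ hβ₀ ?_ ?_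
      fun s hs => hz' s ⟨hs.1, hs.2.trans h₀₂.le⟩
    · exact (ContinuousOn.rpow_const (by fun_prop)
        fun s hs => Or.inl (sub_pos.2 (hs.2.trans_lt h₀₂)).ne').mul
        (hγc.mono (Icc_subset_Icc_right h₀₂.le))
    · intro s hs
      rw [r0, abs_sub_comm, abs_of_pos (sub_pos.2 hs.2)]
      ring
  · refine tendsto_cauchy_sum_jacobi (ψ := fun s => (s - η₁) ^ β₁ * γ s) h₀₂ hβ₀ hβ₂ ?_ ?_
      fun s hs => hz' s ⟨h₁₀.le.trans hs.1, hs.2⟩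
    · exact (ContinuousOn.rpow_const (by fun_prop)
        fun s hs => Or.inl (sub_pos.2 (h₁₀.trans_le hs.1)).ne').mul
        (hγc.mono (Icc_subset_Icc_left h₁₀.le))
    · intro s hs
      rw [r0, abs_of_pos (sub_pos.2 hs.1)]
      ring
end

section
/- Let 0 < η₁ < η₀ < η₂, let β₁, β₂ > −1, let c > 0 with c ≠ 1, let γ : [η₁, η₂] → ℝ be continuous and strictly positive, let χ_c(λ) = 1 for λ ∈ [η₁, η₀) and χ_c(λ) = c² for λ ∈ (η₀, η₂], and set r_c(λ) = (λ−η₁)^{β₁} (η₂−λ)^{β₂} χ_c(λ) γ(λ). For positive integers N₁, N₂ set λ_{1,j} = η₁ + j(η₀−η₁)/(N₁+1) for j = 1,…,N₁ and λ_{2,j} = η₀ + j(η₂−η₀)/(N₂+1) for j = 1,…,N₂. Then for every λ ∈ ℂ ∖ [η₁, η₂]: Σ_{j=1}^{N₁} (η₀−η₁) r_c(λ_{1,j}) / (2N₁π (λ − λ_{1,j})) → (1/(2π)) ∫_{η₁}^{η₀} r_c(s)/(λ − s) ds as N₁ → ∞, and Σ_{j=1}^{N₂} (η₂−η₀) r_c(λ_{2,j})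 / (2N₂π (λ − λ_{2,j})) → (1/(2π)) ∫_{η₀}^{η₂} r_c(s)/(λ − s) ds as N₂ → ∞. -/
open MeasureTheory Set Filter

/-- The step function `χ_c`, equal to `1` on `[η₁, η₀)` and to `c²` on `(η₀, η₂]`. -/
noncomputable def chiStep (η₀ c : ℝ) (l : ℝ) : ℝ :=
  if l < η₀ then 1 else c ^ 2

/-- The second generalized reflection coefficient
`r_c(λ) = (λ-η₁)^{β₁} (η₂-λ)^{β₂} χ_c(λ) γ(λ)`. -/
noncomputable def rc (η₁ η₀ η₂ β₁ β₂ c : ℝ) (γ : ℝ → ℝ) (l : ℝ) : ℝ :=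
  (l - η₁) ^ β₁ * (η₂ - l) ^ β₂ * chiStep η₀ c l * γ l

/-- The value at `s` of the step function interpolating `f` from the right endpoints of the cells
of the uniform partition of `[a, b]` into `N + 1` cells; it vanishes beyond the `N`-th node. -/
noncomputable def rightStep (f : ℝ → ℂ) (a b : ℝ) (N : ℕ) (s : ℝ) : ℂ :=
  ∑ j ∈ Finset.Icc 1 N,
    (Ioc (a + ((j : ℝ) - 1) * (b - a) / ((N : ℝ) + 1))
      (a + j * (b - a) / ((N : ℝ) + 1))).indicator
        (fun _ => f (a + j * (b - a) / ((N : ℝ) + 1))) s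

lemma rightStep_eq_ite {f : ℝ → ℂ} {a b : ℝ} (hab : a < b) (N : ℕ) (s : ℝ) :
    rightStep f a b N s =
      if ⌈(s - a) / ((b - a) / ((N : ℝ) + 1))⌉₊ ∈ Finset.Icc 1 N then
        f (a + (⌈(s - a) / ((b - a) / ((N : ℝ) + 1))⌉₊ : ℝ) * (b - a) / ((N : ℝ) + 1))
      else 0 := by
  have hh : 0 < (b - a) / ((N : ℝ) + 1) := div_pos (sub_pos.2 hab) (by positivity)
  rw [← Finset.sum_ite_eq (Finset.Icc 1 N) ⌈(s - a) / ((b - a) / ((N : ℝ) + 1))⌉₊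
    (fun j : ℕ => f (a + j * (b - a) / ((N : ℝ) + 1))), rightStep]
  refine Finset.sum_congr rfl fun j hj => ?_
  have hj1 : 1 ≤ j := (Finset.mem_Icc.1 hj).1
  rw [indicator_apply]
  refine if_congr ?_ rfl rfl
  rw [Nat.ceil_eq_iff (by omega), Nat.cast_sub hj1, lt_div_iff₀ hh, div_le_iff₀ hh, mem_Ioc,
    mul_div_assoc, mul_div_assoc, lt_sub_iff_add_lt', sub_le_iff_le_add', Nat.cast_one]

lemma node_mem_Ioo {a b : ℝ} (hab : a < b) {N j : ℕ} (hj : j ∈ Finset.Icc 1 N) :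
    a + j * (b - a) / ((N : ℝ) + 1) ∈ Ioo a b := by
  obtain ⟨h1, h2⟩ := Finset.mem_Icc.1 hj
  have hba : 0 < b - a := sub_pos.2 hab
  have h1' : (0 : ℝ) < j := by exact_mod_cast h1
  have h2' : (j : ℝ) ≤ N := by exact_mod_cast h2
  have hN : (0 : ℝ) < (N : ℝ) + 1 := by positivity
  have hlt : j * (b - a) / ((N : ℝ) + 1) < b - a := by
    rw [div_lt_iff₀ hN]; nlinarith
  have hpos : 0 < j * (b - a) / ((N : ℝ) + 1) := by positivity
  constructor <;> linarith

lemma integral_rightStep {f : ℝ → ℂ} {a b : ℝ} (hab : a < b) (N : ℕ) :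
    ∫ s in Ioo a b, rightStep f a b N s =
      (((b - a) / ((N : ℝ) + 1) : ℝ) : ℂ) *
        ∑ j ∈ Finset.Icc 1 N, f (a + j * (b - a) / ((N : ℝ) + 1)) := by
  have hba : 0 < b - a := sub_pos.2 hab
  unfold rightStep
  rw [integral_finsetSum, Finset.mul_sum]
  · refine Finset.sum_congr rfl fun j hj => ?_
    have hsub : Ioc (a + ((j : ℝ) - 1) * (b - a) / ((N : ℝ) + 1))
        (a + j * (b - a) / ((N : ℝ) + 1)) ⊆ Ioo a b := by
      intro s hs
      have h1 : (1 : ℝ) ≤ j := by exact_mod_cast (Finset.mem_Icc.1 hj).1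
      have h0 : 0 ≤ ((j : ℝ) - 1) * (b - a) / ((N : ℝ) + 1) :=
        div_nonneg (mul_nonneg (by linarith) hba.le) (by positivity)
      exact ⟨by linarith [hs.1], hs.2.trans_lt (node_mem_Ioo hab hj).2⟩
    rw [setIntegral_indicator measurableSet_Ioc, inter_eq_self_of_subset_right hsub,
      setIntegral_const, Real.volume_real_Ioc_of_le, Complex.real_smul]
    · congr 2
      ring
    · gcongr
      linarith
  · intro j _
    exact (integrable_const _).indicator measurableSet_Ioc

lemma norm_rightStep_le {f : ℝ → ℂ} {g : ℝ → ℝ} {a b : ℝ} (hab : a < b)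
    (hg : AntitoneOn g (Ioo a b)) (hfg : ∀ s ∈ Ioo a b, ‖f s‖ ≤ g s) (N : ℕ) {s : ℝ}
    (hs : s ∈ Ioo a b) : ‖rightStep f a b N s‖ ≤ g s := by
  have hh : 0 < (b - a) / ((N : ℝ) + 1) := div_pos (sub_pos.2 hab) (by positivity)
  rw [rightStep_eq_ite hab]
  split_ifs with hj
  · have hx := node_mem_Ioo hab hj
    refine (hfg _ hx).trans (hg hs hx ?_)
    have := Nat.le_ceil ((s - a) / ((b - a) / ((N : ℝ) + 1)))
    rw [div_le_iff₀ hh, ← mul_div_assoc] at this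
    linarith
  · simpa using (norm_nonneg _).trans (hfg s hs)

lemma tendsto_rightStep {f : ℝ → ℂ} {a b : ℝ} (hab : a < b) (hf : ContinuousOn f (Ioo a b))
    {s : ℝ} (hs : s ∈ Ioo a b) :
    Tendsto (fun N : ℕ => rightStep f a b N s) atTop (nhds (f s)) := by
  have hh (N : ℕ) : 0 < (b - a) / ((N : ℝ) + 1) :=
    div_pos (sub_pos.2 hab) (by positivity)
  have hmesh : Tendsto (fun N : ℕ => (b - a) / ((N : ℝ) + 1)) atTop (nhds 0) :=
    tendsto_const_nhds.div_atTop (tendsto_natCast_atTop_atTop.atTop_add tendsto_const_nhds)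
  have hnode : Tendsto (fun N : ℕ =>
      a + (⌈(s - a) / ((b - a) / ((N : ℝ) + 1))⌉₊ : ℝ) * (b - a) / ((N : ℝ) + 1))
      atTop (nhds s) := by
    refine tendsto_of_tendsto_of_tendsto_of_le_of_le (g := fun _ => s)
      (h := fun N : ℕ => s + (b - a) / ((N : ℝ) + 1)) tendsto_const_nhds
      (by simpa using hmesh.const_add s) (fun N => ?_) (fun N => ?_)
    · have := Nat.le_ceil ((s - a) / ((b - a) / ((N : ℝ) + 1)))
      rw [div_le_iff₀ (hh N), ← mul_div_assoc] at this
      change s ≤ _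
      linarith
    · have := (Nat.ceil_lt_add_one (div_nonneg (sub_nonneg.2 hs.1.le) (hh N).le)).le
      have := mul_le_mul_of_nonneg_right this (hh N).le
      rw [add_mul, div_mul_cancel₀ _ (hh N).ne', ← mul_div_assoc] at this
      change _ ≤ s + _
      linarith
  refine ((hf.continuousAt (Ioo_mem_nhds hs.1 hs.2)).tendsto.comp hnode).congr' ?_
  filter_upwards [hnode.eventually (gt_mem_nhds hs.2)] with N hN
  rw [rightStep_eq_ite hab, if_pos]
  · rfl
  · refine Finset.mem_Icc.2 ⟨Nat.one_le_ceil_iff.2 (div_pos (sub_pos.2 hs.1) (hh N)), ?_⟩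
    have hlt := lt_sub_iff_add_lt'.2 hN
    rw [div_lt_iff₀ (by positivity), mul_comm (b - a)] at hlt
    have := lt_of_mul_lt_mul_right hlt (sub_pos.2 hab).le
    exact Nat.lt_succ_iff.1 (by exact_mod_cast this)

/-- Uniform Riemann sums over interior nodes converge to the integral for a continuous function
dominated by an integrable antitone function. -/
lemma tendsto_interior_sum_of_antitone_bound {f : ℝ → ℂ} {g : ℝ → ℝ} {a b : ℝ} (hab : a < b)
    (hf : ContinuousOn f (Ioo a b)) (hg : AntitoneOn g (Ioo a b))
    (hgi : IntegrableOn g (Ioo a b)) (hfg : ∀ s ∈ Ioo a b, ‖f s‖ ≤ g s) :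
    Tendsto (fun N : ℕ => (((b - a) / N : ℝ) : ℂ) *
        ∑ j ∈ Finset.Icc 1 N, f (a + j * (b - a) / ((N : ℝ) + 1)))
      atTop (nhds (∫ s in Ioo a b, f s)) := by
  have hmain : Tendsto (fun N : ℕ => ∫ s in Ioo a b, rightStep f a b N s) atTop
      (nhds (∫ s in Ioo a b, f s)) := by
    refine tendsto_integral_of_dominated_convergence g (fun N => ?_) hgi (fun N => ?_) ?_
    · unfold rightStep
      exact (Finset.measurable_sum _ fun j _ =>
        measurable_const.indicator measurableSet_Ioc).aestronglyMeasurable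
    · filter_upwards [ae_restrict_mem measurableSet_Ioo] with s hs
      exact norm_rightStep_le hab hg hfg N hs
    · filter_upwards [ae_restrict_mem measurableSet_Ioo] with s hs
      exact tendsto_rightStep hab hf hs
  have hratio : Tendsto (fun N : ℕ => ((1 + 1 / (N : ℝ) : ℝ) : ℂ)) atTop (nhds 1) := by
    have := (tendsto_one_div_atTop_nhds_zero_nat (𝕜 := ℝ)).const_add 1
    rw [add_zero] at this
    rw [← Complex.ofReal_one]
    exact (Complex.continuous_ofReal.tendsto 1).comp this
  have := hratio.mul hmain
  rw [one_mul] at this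
  refine this.congr' ?_
  filter_upwards [eventually_gt_atTop 0] with N hN
  have hN' : (N : ℝ) ≠ 0 := by positivity
  have hN1 : (N : ℝ) + 1 ≠ 0 := by positivity
  rw [integral_rightStep hab, ← mul_assoc, ← Complex.ofReal_mul]
  congr 2
  field_simp

/-- Interior uniform Riemann sums converge for a continuous function times a power singularity at
the left endpoint. -/
lemma tendsto_interior_sum_of_left_rpow {f φ : ℝ → ℂ} {a b β : ℝ} (hab : a < b) (hβ : -1 < β)
    (hφ : ContinuousOn φ (Icc a b))
    (hf : ∀ s ∈ Ioo a b, f s = (((s - a) ^ β : ℝ) : ℂ) * φ s) :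
    Tendsto (fun N : ℕ => (((b - a) / N : ℝ) : ℂ) *
        ∑ j ∈ Finset.Icc 1 N, f (a + j * (b - a) / ((N : ℝ) + 1)))
      atTop (nhds (∫ s in Ioo a b, f s)) := by
  obtain ⟨C, hC⟩ := isCompact_Icc.exists_bound_of_continuousOn hφ
  have hC0 : 0 ≤ C := (norm_nonneg _).trans (hC a (left_mem_Icc.2 hab.le))
  have hK : 0 ≤ C * (b - a) ^ max β 0 := mul_nonneg hC0 (Real.rpow_nonneg (by linarith) _)
  refine tendsto_interior_sum_of_antitone_bound hab
    (g := fun s => C * (b - a) ^ max β 0 * (s - a) ^ min β 0) ?_ ?_ ?_ ?_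
  · refine ContinuousOn.congr (f := fun s => (((s - a) ^ β : ℝ) : ℂ) * φ s) ?_ hf
    refine ContinuousOn.mul ?_ (hφ.mono Ioo_subset_Icc_self)
    refine Complex.continuous_ofReal.comp_continuousOn ?_
    exact (continuousOn_id.sub continuousOn_const).rpow_const
      fun s hs => Or.inl (sub_pos.2 hs.1).ne'
  · intro s hs t ht hst
    refine mul_le_mul_of_nonneg_left ?_ hK
    exact Real.rpow_le_rpow_of_nonpos (sub_pos.2 hs.1) (by linarith) (min_le_right _ _)
  · have h := (intervalIntegral.intervalIntegrable_rpow' (a := a - a) (b := b - a)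
      (lt_min hβ (by norm_num : (-1 : ℝ) < 0))).comp_sub_right a
    rw [sub_add_cancel, sub_add_cancel, intervalIntegrable_iff_integrableOn_Ioo_of_le hab.le] at h
    exact h.const_mul _
  · intro s hs
    have hpos := sub_pos.2 hs.1
    have hsplit : (s - a) ^ β = (s - a) ^ max β 0 * (s - a) ^ min β 0 := by
      rw [← Real.rpow_add hpos, max_add_min, add_zero]
    rw [hf s hs, norm_mul, Complex.norm_real, Real.norm_of_nonneg (Real.rpow_nonneg hpos.le _),
      mul_comm, hsplit, ← mul_assoc]
    refine mul_le_mul_of_nonneg_right ?_ (Real.rpow_nonneg hpos.le _)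
    exact mul_le_mul (hC s (Ioo_subset_Icc_self hs))
      (Real.rpow_le_rpow hpos.le (by linarith [hs.2]) (le_max_right _ _))
      (Real.rpow_nonneg hpos.le _) hC0

/-- Interior uniform Riemann sums converge for a continuous function times a power singularity at
the right endpoint. -/
lemma tendsto_interior_sum_of_right_rpow {f φ : ℝ → ℂ} {a b β : ℝ} (hab : a < b) (hβ : -1 < β)
    (hφ : ContinuousOn φ (Icc a b))
    (hf : ∀ s ∈ Ioo a b, f s = (((b - s) ^ β : ℝ) : ℂ) * φ s) :
    Tendsto (fun N : ℕ => (((b - a) / N : ℝ) : ℂ) *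
        ∑ j ∈ Finset.Icc 1 N, f (a + j * (b - a) / ((N : ℝ) + 1)))
      atTop (nhds (∫ s in Ioo a b, f s)) := by
  have h := tendsto_interior_sum_of_left_rpow (f := fun s => f (-s)) (φ := fun s => φ (-s))
    (neg_lt_neg hab) hβ
    (hφ.comp continuous_neg.continuousOn fun s hs => ⟨le_neg.1 hs.2, neg_le.1 hs.1⟩)
    (fun s hs => by
      rw [hf (-s) ⟨lt_neg.1 hs.2, neg_lt.1 hs.1⟩]
      rw [sub_neg_eq_add, sub_neg_eq_add, add_comm])
  have hint : ∫ s in Ioo (-b) (-a), f (-s) = ∫ s in Ioo a b, f s := by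
    rw [← integral_Ioc_eq_integral_Ioo, ← integral_Ioc_eq_integral_Ioo,
      ← intervalIntegral.integral_of_le (neg_le_neg hab.le),
      ← intervalIntegral.integral_of_le hab.le, intervalIntegral.integral_comp_neg,
      neg_neg, neg_neg]
  rw [hint] at h
  refine h.congr fun N => ?_
  congr 1
  · congr 2
    ring
  · refine Finset.sum_nbij' (fun j => N + 1 - j) (fun j => N + 1 - j) ?_ ?_ ?_ ?_ ?_
    · intro j hj; simp only [Finset.mem_Icc] at hj ⊢; omega
    · intro j hj; simp only [Finset.mem_Icc] at hj ⊢; omega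
    · intro j hj; simp only [Finset.mem_Icc] at hj; omega
    · intro j hj; simp only [Finset.mem_Icc] at hj; omega
    · intro j hj
      rw [Nat.cast_sub (by simp only [Finset.mem_Icc] at hj; omega)]
      congr 1
      have : (N : ℝ) + 1 ≠ 0 := by positivity
      push_cast
      field_simp
      ring

/-- Rescaling a convergent Riemann sum of `r / (z - ·)` to the normalisation of soliton sums. -/
lemma tendsto_cauchy_sum {r : ℝ → ℝ} {a b : ℝ} {z : ℂ}
    (h : Tendsto (fun N : ℕ => (((b - a) / N : ℝ) : ℂ) *
        ∑ j ∈ Finset.Icc 1 N, (fun s : ℝ => (r s : ℂ) / (z - (s : ℂ)))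
          (a + j * (b - a) / ((N : ℝ) + 1)))
      atTop (nhds (∫ s in Ioo a b, (r s : ℂ) / (z - (s : ℂ))))) :
    Tendsto (fun N : ℕ => ∑ j ∈ Finset.Icc 1 N,
        (((b - a) * r (a + j * (b - a) / ((N : ℝ) + 1)) : ℝ) : ℂ) /
          (((2 * N * Real.pi : ℝ) : ℂ) * (z - ((a + j * (b - a) / ((N : ℝ) + 1) : ℝ) : ℂ))))
      atTop (nhds (((1 / (2 * Real.pi) : ℝ) : ℂ) *
        ∫ s in Ioo a b, (r s : ℂ) / (z - (s : ℂ)))) := by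
  refine (h.const_mul ((1 / (2 * Real.pi) : ℝ) : ℂ)).congr fun N => ?_
  rw [← mul_assoc, Finset.mul_sum]
  refine Finset.sum_congr rfl fun j _ => ?_
  generalize a + j * (b - a) / ((N : ℝ) + 1) = x
  push_cast
  simp only [div_eq_mul_inv, mul_inv]
  ring

theorem cauchy_sums_converge_for_rc
    (η₁ η₀ η₂ β₁ β₂ c : ℝ) (γ : ℝ → ℝ)
    (hη₁ : 0 < η₁) (h₁₀ : η₁ < η₀) (h₀₂ : η₀ < η₂)
    (hβ₁ : -1 < β₁) (hβ₂ : -1 < β₂) (hc : 0 < c) (hc1 : c ≠ 1)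
    (hγc : ContinuousOn γ (Icc η₁ η₂)) (hγpos : ∀ s ∈ Icc η₁ η₂, 0 < γ s) :
    ∀ z : ℂ, z ∉ (fun s : ℝ => (s : ℂ)) '' Icc η₁ η₂ →
      Tendsto
        (fun N₁ : ℕ =>
          ∑ j ∈ Finset.Icc 1 N₁,
            (((η₀ - η₁) * rc η₁ η₀ η₂ β₁ β₂ c γ (η₁ + j * (η₀ - η₁) / ((N₁ : ℝ) + 1)) : ℝ) : ℂ) /
              (((2 * N₁ * Real.pi : ℝ) : ℂ) *
                (z - ((η₁ + j * (η₀ - η₁) / ((N₁ : ℝ) + 1) : ℝ) : ℂ))))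
        atTop
        (nhds (((1 / (2 * Real.pi) : ℝ) : ℂ) *
          ∫ s in Ioo η₁ η₀, (rc η₁ η₀ η₂ β₁ β₂ c γ s : ℂ) / (z - (s : ℂ)))) ∧
      Tendsto
        (fun N₂ : ℕ =>
          ∑ j ∈ Finset.Icc 1 N₂,
            (((η₂ - η₀) * rc η₁ η₀ η₂ β₁ β₂ c γ (η₀ + j * (η₂ - η₀) / ((N₂ : ℝ) + 1)) : ℝ) : ℂ) /
              (((2 * N₂ * Real.pi : ℝ) : ℂ) *
                (z - ((η₀ + j * (η₂ - η₀) / ((N₂ : ℝ) + 1) : ℝ) : ℂ))))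
        atTop
        (nhds (((1 / (2 * Real.pi) : ℝ) : ℂ) *
          ∫ s in Ioo η₀ η₂, (rc η₁ η₀ η₂ β₁ β₂ c γ s : ℂ) / (z - (s : ℂ)))) := by
  intro z hz
  have hne : ∀ s ∈ Icc η₁ η₂, z - (s : ℂ) ≠ 0 := fun s hs h =>
    hz ⟨s, hs, (sub_eq_zero.1 h).symm⟩
  have hγz : ContinuousOn (fun s : ℝ => (γ s : ℂ) / (z - (s : ℂ))) (Icc η₁ η₂) :=
    (Complex.continuous_ofReal.comp_continuousOn hγc).div
      (continuous_const.sub Complex.continuous_ofReal).continuousOn hne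
  constructor
  · refine tendsto_cauchy_sum (r := rc η₁ η₀ η₂ β₁ β₂ c γ) (tendsto_interior_sum_of_left_rpow
      (f := fun s => (rc η₁ η₀ η₂ β₁ β₂ c γ s : ℂ) / (z - (s : ℂ)))
      (φ := fun s => (((η₂ - s) ^ β₂ : ℝ) : ℂ) * ((γ s : ℂ) / (z - (s : ℂ)))) h₁₀ hβ₁ ?_ ?_)
    · refine ContinuousOn.mul (Complex.continuous_ofReal.comp_continuousOn ?_)
        (hγz.mono (Icc_subset_Icc_right h₀₂.le))
      exact (continuousOn_const.sub continuousOn_id).rpow_const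
        fun s hs => Or.inl (sub_pos.2 (hs.2.trans_lt h₀₂)).ne'
    · intro s hs
      simp only [rc, chiStep, if_pos hs.2]
      push_cast
      ring
  · refine tendsto_cauchy_sum (r := rc η₁ η₀ η₂ β₁ β₂ c γ) (tendsto_interior_sum_of_right_rpow
      (f := fun s => (rc η₁ η₀ η₂ β₁ β₂ c γ s : ℂ) / (z - (s : ℂ)))
      (φ := fun s => (((s - η₁) ^ β₁ * c ^ 2 : ℝ) : ℂ) * ((γ s : ℂ) / (z - (s : ℂ))))
      h₀₂ hβ₂ ?_ ?_)
    · refine ContinuousOn.mul (Complex.continuous_ofReal.comp_continuousOn ?_)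
        (hγz.mono (Icc_subset_Icc_left h₁₀.le))
      exact ((continuousOn_id.sub continuousOn_const).rpow_const
        fun s hs => Or.inl (sub_pos.2 (h₁₀.trans_le hs.1)).ne').mul continuousOn_const
    · intro s hs
      simp only [rc, chiStep, if_neg hs.1.not_gt]
      push_cast
      ring
end

section
/- Let r, f₊, f₋ be nonzero complex numbers and let t, p₊, p₋ be complex numbers such that f₊·f₋ = r^{−1} and p₊ + p₋ = 0. With L[x] = [[1,0],[x,1]], U[x] = [[1,x],[0,1]], σ₁ = [[0,1],[1,0]], σ₃ = diag(1,−1), a^{σ₃} = diag(a, a^{−1}) for a ∈ ℂ^×, e^{wσ₃} = diag(e^w, e^{−w}), and U^{w}_{d}[x] = e^{wσ₃} d^{−σ₃} U[x] d^{σ₃} e^{−wσ₃}, the following 2×2 matrix identity holds: f₋^{−σ₃} e^{t p₋ σ₃} L[−i r] e^{−t p₊ σ₃} f₊^{σ₃} = U^{t p₋}_{f₋}[i r^{−1}] · (−i σ₁) · U^{t p₊}_{f₊}[i r^{−1}]. -/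
open Matrix

/-- The unipotent lower triangular matrix `L[x]`. -/
noncomputable def Lmat (x : ℂ) : Matrix (Fin 2) (Fin 2) ℂ := !![1, 0; x, 1]

/-- The unipotent upper triangular matrix `U[x]`. -/
noncomputable def Umat (x : ℂ) : Matrix (Fin 2) (Fin 2) ℂ := !![1, x; 0, 1]

/-- The Pauli matrix `σ₁`. -/
noncomputable def pauli1 : Matrix (Fin 2) (Fin 2) ℂ := !![0, 1; 1, 0]

/-- The diagonal matrix `a^{σ₃} = diag(a, a⁻¹)`. -/
noncomputable def dSigma3 (a : ℂ) : Matrix (Fin 2) (Fin 2) ℂ := !![a, 0; 0, a⁻¹]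

/-- The diagonal matrix `e^{w σ₃} = diag(e^w, e^{-w})`. -/
noncomputable def expSigma3 (w : ℂ) : Matrix (Fin 2) (Fin 2) ℂ :=
  !![Complex.exp w, 0; 0, Complex.exp (-w)]

/-- `U^{w}_{d}[x] = e^{wσ₃} d^{-σ₃} U[x] d^{σ₃} e^{-wσ₃}`. -/
noncomputable def UconjD (w d x : ℂ) : Matrix (Fin 2) (Fin 2) ℂ :=
  expSigma3 w * dSigma3 d⁻¹ * Umat x * dSigma3 d * expSigma3 (-w)

theorem band_jump_factorization_upper
    (r fPlus fMinus t pPlus pMinus : ℂ)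
    (hr : r ≠ 0) (hfPlus : fPlus ≠ 0) (hfMinus : fMinus ≠ 0)
    (hf : fPlus * fMinus = r⁻¹) (hp : pPlus + pMinus = 0) :
    dSigma3 fMinus⁻¹ * expSigma3 (t * pMinus) * Lmat (-(Complex.I * r)) *
        expSigma3 (-(t * pPlus)) * dSigma3 fPlus =
      UconjD (t * pMinus) fMinus (Complex.I * r⁻¹) * ((-Complex.I) • pauli1) *
        UconjD (t * pPlus) fPlus (Complex.I * r⁻¹) := by
  obtain rfl : pMinus = -pPlus := by linear_combination hp
  obtain rfl : r = (fPlus * fMinus)⁻¹ := by rw [hf, inv_inv]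
  have hexp := Complex.exp_ne_zero (t * pPlus)
  have hI := Complex.I_sq
  ext i j
  fin_cases i <;> fin_cases j <;>
    simp [UconjD, dSigma3, expSigma3, Lmat, Umat, pauli1, Matrix.mul_apply, Fin.sum_univ_two,
      Complex.exp_neg] <;>
    field_simp <;> grind
end

section
/- Let r, f₊, f₋ be nonzero complex numbers and let t, p₊, p₋ be complex numbers such that f₊·f₋ = r and p₊ + p₋ = 0. With L[x] = [[1,0],[x,1]], U[x] = [[1,x],[0,1]], σ₁ = [[0,1],[1,0]], σ₃ = diag(1,−1), a^{σ₃} = diag(a, a^{−1}) for a ∈ ℂ^×, e^{wσ₃} = diag(e^w, e^{−w}), and L^{w}_{d}[x] = e^{wσ₃} d^{−σ₃} L[x] d^{σ₃} e^{−wσ₃}, the following 2×2 matrix identity holds: f₋^{−σ₃} e^{t p₋ σ₃} U[i r] e^{−t p₊ σ₃} f₊^{σ₃} = L^{t p₋}_{f₋}[−i r^{−1}] · (i σ₁) · L^{t p₊}_{f₊}[−i r^{−1}]. -/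
open Matrix

/-- `L^{w}_{d}[x] = e^{wσ₃} d^{-σ₃} L[x] d^{σ₃} e^{-wσ₃}`. -/
noncomputable def LconjD (w d x : ℂ) : Matrix (Fin 2) (Fin 2) ℂ :=
  expSigma3 w * dSigma3 d⁻¹ * Lmat x * dSigma3 d * expSigma3 (-w)

/-- Conjugating `L[x]` by diagonal matrices rescales its lower left entry. -/
theorem LconjD_eq_Lmat (w x : ℂ) {d : ℂ} (hd : d ≠ 0) :
    LconjD w d x = Lmat (x * d ^ 2 * Complex.exp (-w) ^ 2) := by
  have hw : Complex.exp w * Complex.exp (-w) = 1 := by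
    rw [← Complex.exp_add, add_neg_cancel, Complex.exp_zero]
  ext i j
  fin_cases i <;> fin_cases j <;>
    simp [LconjD, Lmat, dSigma3, expSigma3, Matrix.mul_apply, Fin.sum_univ_two] <;>
    field_simp <;> linear_combination hw

theorem band_jump_factorization_lower
    (r fPlus fMinus t pPlus pMinus : ℂ)
    (hr : r ≠ 0) (hfPlus : fPlus ≠ 0) (hfMinus : fMinus ≠ 0)
    (hf : fPlus * fMinus = r) (hp : pPlus + pMinus = 0) :
    dSigma3 fMinus⁻¹ * expSigma3 (t * pMinus) * Umat (Complex.I * r) *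
        expSigma3 (-(t * pPlus)) * dSigma3 fPlus =
      LconjD (t * pMinus) fMinus (-(Complex.I * r⁻¹)) * (Complex.I • pauli1) *
        LconjD (t * pPlus) fPlus (-(Complex.I * r⁻¹)) := by
  obtain rfl : pPlus = -pMinus := eq_neg_of_add_eq_zero_left hp
  subst hf
  rw [LconjD_eq_Lmat _ _ hfPlus, LconjD_eq_Lmat _ _ hfMinus]
  have hE : Complex.exp (t * pMinus) ≠ 0 := Complex.exp_ne_zero _
  ext i j
  fin_cases i <;> fin_cases j <;>
    simp [Lmat, Umat, pauli1, dSigma3, expSigma3, Matrix.mul_apply, Fin.sum_univ_two,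
      Complex.exp_neg] <;>
    field_simp <;> simp [Complex.I_sq]
end
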